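/- The following strict inclusions hold between the classes of binary tree translations: TT ⊊ FT ⊊ MTT ⊊ MFT, i.e., every top-down tree transducer translation is a forest transducer translation, every forest transducer translation is a macro tree transducer translation, every macro tree transducer translation is a macro forest transducer translation, and each inclusion is strict. -/

import Mathlib

set_option autoImplicit true
set_option maxHeartbeats 1000000

/-! ## XML forests (in first-child next-sibling style, also serving as binary XML trees) -/

/-- Node types: element, attribute, text nodes. -/
inductive NodeKind where
  | elem | attr | text
deriving DecidableEq, Repr

/-- Nonempty words over the universal alphabet `U` (= `Char`). -/
abbrev Word : Type := {w : List Char // w ≠ []}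

/-- A node label: a type together with a name (a nonempty word over `U`). -/
abbrev Label : Type := NodeKind × Word

/-- XML forests; `node l c r` is a tree with root label `l`, children forest `c`,
followed by the forest `r` of further trees of the sequence.  Under the
first-child next-sibling correspondence this type also represents binary XML
trees (with `eps` the ε-leaves and every labeled node binary), and the
encoding `fcns` is the identity of this representation. -/
inductive Forest where
  | eps : Forest
  | node : Label → Forest → Forest → Forest
deriving DecidableEq, Repr

namespace Forest

/-- Concatenation of forests. -/
def append : Forest → Forest → Forest
  | .eps, g => g
  | .node l c r, g => .node l c (append r g)

/-- The size of a forest = its number of nodes. -/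
def size : Forest → ℕ
  | .eps => 0
  | .node _ c r => 1 + c.size + r.size

/-- Height of a binary XML tree (length of the longest root-to-leaf path). -/
def height : Forest → ℕ
  | .eps => 0
  | .node _ c r => 1 + max c.height r.height

/-- All labels of the forest belong to `S`. -/
def labelsIn (S : Finset Label) : Forest → Prop
  | .eps => True
  | .node l c r => l ∈ S ∧ c.labelsIn S ∧ r.labelsIn S

end Forest

/-! ## Macro forest transducers -/

/-- Input variables: `x0` binds the current node together with the rest of the
stream, `x1` the children of the current node, `x2` the rest of the stream. -/
inductive XVar where
  | x0 | x1 | x2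
deriving DecidableEq, Repr

def XVar.sel : XVar → Forest → Forest → Forest → Forest
  | .x0, g0, _, _ => g0
  | .x1, _, g1, _ => g1
  | .x2, _, _, g2 => g2

/-- Right-hand sides of MFT rules: forests over `Σ ∪ Q ∪ {x0,x1,x2} ∪ Y`,
where a leaf is labeled by an input variable exactly if it is the first child of
a state-labeled node (constructor `call`), parameters occur only at leaves
(constructor `param`, with the remainder of the forest sequence), and `tnode`
is a `%t`-labeled node (only allowed in default rules). -/
inductive RHS (Q : Type) where
  | eps   : RHS Q
  | node  : Label → RHS Q → RHS Q → RHS Q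
  | tnode : RHS Q → RHS Q → RHS Q
  | param : ℕ → RHS Q → RHS Q
  | call  : Q → XVar → List (RHS Q) → RHS Q → RHS Q

namespace RHS

/-- Number of nodes of a right-hand side. -/
def size : RHS Q → ℕ
  | .eps => 0
  | .node _ c r => 1 + c.size + r.size
  | .tnode c r => 1 + c.size + r.size
  | .param _ r => 1 + r.size
  | .call _ _ args r => 1 + (args.attach.map (fun a => a.1.size)).sum + r.size
decreasing_by
  all_goals simp_wf
  all_goals try omega
  all_goals (have := List.sizeOf_lt_of_mem a.2; omega)


/-- Concatenation of right-hand-side forests. -/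
def append : RHS Q → RHS Q → RHS Q
  | .eps, t => t
  | .node l c r, t => .node l c (r.append t)
  | .tnode c r, t => .tnode c (r.append t)
  | .param j r, t => .param j (r.append t)
  | .call p x as r, t => .call p x as (r.append t)

mutual
/-- All calls in the right-hand side use only the input variable `x0`. -/
def varsOnly0 : RHS Q → Prop
  | .eps => True
  | .node _ c r => c.varsOnly0 ∧ r.varsOnly0
  | .tnode c r => c.varsOnly0 ∧ r.varsOnly0
  | .param _ r => r.varsOnly0
  | .call _ x args r => x = .x0 ∧ varsOnly0L args ∧ r.varsOnly0
def varsOnly0L : List (RHS Q) → Prop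
  | [] => True
  | a :: as => a.varsOnly0 ∧ varsOnly0L as
end

mutual
/-- No `%t`-labeled node occurs. -/
def noT : RHS Q → Prop
  | .eps => True
  | .node _ c r => c.noT ∧ r.noT
  | .tnode _ _ => False
  | .param _ r => r.noT
  | .call _ _ args r => noTL args ∧ r.noT
def noTL : List (RHS Q) → Prop
  | [] => True
  | a :: as => a.noT ∧ noTL as
end

mutual
/-- All labels of the right-hand side belong to `S`. -/
def labelsIn (S : Finset Label) : RHS Q → Prop
  | .eps => True
  | .node l c r => l ∈ S ∧ c.labelsIn S ∧ r.labelsIn S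
  | .tnode c r => c.labelsIn S ∧ r.labelsIn S
  | .param _ r => r.labelsIn S
  | .call _ _ args r => labelsInL S args ∧ r.labelsIn S
def labelsInL (S : Finset Label) : List (RHS Q) → Prop
  | [] => True
  | a :: as => a.labelsIn S ∧ labelsInL S as
end

mutual
/-- Ranks are respected: every state call `q` carries exactly `prm q` parameter
arguments and the parameters used are among `y₁,…,y_m`. -/
def arityOK (prm : Q → ℕ) (m : ℕ) : RHS Q → Prop
  | .eps => True
  | .node _ c r => c.arityOK prm m ∧ r.arityOK prm m
  | .tnode c r => c.arityOK prm m ∧ r.arityOK prm m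
  | .param j r => j < m ∧ r.arityOK prm m
  | .call q _ args r => args.length = prm q ∧ arityOKL prm m args ∧ r.arityOK prm m
def arityOKL (prm : Q → ℕ) (m : ℕ) : List (RHS Q) → Prop
  | [] => True
  | a :: as => a.arityOK prm m ∧ arityOKL prm m as
end

mutual
/-- No stay move: no call `q'(x₀)` occurs. -/
def noStay : RHS Q → Prop
  | .eps => True
  | .node _ c r => c.noStay ∧ r.noStay
  | .tnode c r => c.noStay ∧ r.noStay
  | .param _ r => r.noStay
  | .call _ x args r => x ≠ .x0 ∧ noStayL args ∧ r.noStay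
def noStayL : List (RHS Q) → Prop
  | [] => True
  | a :: as => a.noStay ∧ noStayL as
end

mutual
/-- The right-hand side is a **tree** in which every labeled node is binary
(reading `node l c r` as the binary node `l(c,r)`); parameters and state calls
occur as leaves of this tree (empty continuation). -/
def isTree : RHS Q → Prop
  | .eps => True
  | .node _ c r => c.isTree ∧ r.isTree
  | .tnode c r => c.isTree ∧ r.isTree
  | .param _ r => r = .eps
  | .call _ _ args r => isTreeL args ∧ r = .eps
def isTreeL : List (RHS Q) → Prop
  | [] => True
  | a :: as => a.isTree ∧ isTreeL as
end

end RHS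

/-- A macro forest transducer (MFT) over the finite set `sig ⊆ U⁺` of symbols:
a finite ranked set `Q` of states (state `q` has `prm q` accumulating
parameters, i.e. rank `prm q + 1`), an initial state `q0` of rank 1, and for
every state at most one `(q,σ)`-rule per symbol `σ ∈ sig`, exactly one ε-rule
and exactly one default rule. -/
structure MFT where
  Q : Type
  [fintypeQ : Fintype Q]
  [deceqQ : DecidableEq Q]
  prm : Q → ℕ
  q0 : Q
  sig : Finset Label
  ruleSym : Q → Label → Option (RHS Q)
  ruleEps : Q → RHS Q
  ruleDef : Q → RHS Q

attribute [instance] MFT.fintypeQ MFT.deceqQ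

/-- Well-formedness of an MFT, as required by the definition: the initial state
has rank 1; `(q,σ)`-rules only for `σ ∈ sig`; `(q,σ)`-rules contain no `%t`;
ε-rules contain no `%t` and use only the input variable `x0`; all labels in
right-hand sides are symbols of `sig`; all rules respect the ranks of states. -/
def MFT.WF (M : MFT) : Prop :=
  M.prm M.q0 = 0 ∧
  (∀ q a, a ∉ M.sig → M.ruleSym q a = none) ∧
  (∀ q a r, M.ruleSym q a = some r →
      r.noT ∧ r.labelsIn M.sig ∧ r.arityOK M.prm (M.prm q)) ∧
  (∀ q : M.Q, (M.ruleEps q).noT ∧ (M.ruleEps q).varsOnly0 ∧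
      (M.ruleEps q).labelsIn M.sig ∧ (M.ruleEps q).arityOK M.prm (M.prm q)) ∧
  (∀ q : M.Q, (M.ruleDef q).labelsIn M.sig ∧ (M.ruleDef q).arityOK M.prm (M.prm q))

mutual
/-- Big-step semantics of states: `Eval M q g ys out` means
`⟦q⟧(g, ys) = out`: the unique applicable rule of `q` on input `g` is chosen
(the ε-rule if `g = ε`, the `(q,σ)`-rule if `g = σ(g₁)g₂` and it exists,
otherwise the default rule) and its right-hand side evaluated. -/
inductive Eval (M : MFT) : M.Q → Forest → List Forest → Forest → Prop where
  | eps : ∀ (q : M.Q) (ys : List Forest) (out : Forest),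
      EvalR M (M.ruleEps q) .eps .eps .eps none ys out →
      Eval M q .eps ys out
  | sym : ∀ (q : M.Q) (l : Label) (c r : Forest) (rh : RHS M.Q) ys out,
      M.ruleSym q l = some rh →
      EvalR M rh (.node l c r) c r (some l) ys out →
      Eval M q (.node l c r) ys out
  | dflt : ∀ (q : M.Q) (l : Label) (c r : Forest) ys out,
      M.ruleSym q l = none →
      EvalR M (M.ruleDef q) (.node l c r) c r (some l) ys out →
      Eval M q (.node l c r) ys out

/-- Evaluation of right-hand sides: `EvalR M rh g0 g1 g2 lab ys out`; here `g0`
is bound to `x0`, `g1` to `x1`, `g2` to `x2`, `lab` is the label of the current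
node (for `%t`-nodes), and `ys` are the values of the parameters. -/
inductive EvalR (M : MFT) : RHS M.Q → Forest → Forest → Forest → Option Label →
    List Forest → Forest → Prop where
  | eps : ∀ g0 g1 g2 lab ys, EvalR M .eps g0 g1 g2 lab ys .eps
  | node : ∀ (l : Label) c r g0 g1 g2 lab ys oc orr,
      EvalR M c g0 g1 g2 lab ys oc → EvalR M r g0 g1 g2 lab ys orr →
      EvalR M (.node l c r) g0 g1 g2 lab ys (.node l oc orr)
  | tnode : ∀ (l : Label) c r g0 g1 g2 ys oc orr,
      EvalR M c g0 g1 g2 (some l) ys oc → EvalR M r g0 g1 g2 (some l) ys orr →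
      EvalR M (.tnode c r) g0 g1 g2 (some l) ys (.node l oc orr)
  | param : ∀ (j : ℕ) r g0 g1 g2 lab ys orr,
      EvalR M r g0 g1 g2 lab ys orr →
      EvalR M (.param j r) g0 g1 g2 lab ys ((ys.getD j .eps).append orr)
  | call : ∀ (p : M.Q) (x : XVar) args cont g0 g1 g2 lab ys vs oq orr,
      EvalL M args g0 g1 g2 lab ys vs →
      Eval M p (x.sel g0 g1 g2) vs oq →
      EvalR M cont g0 g1 g2 lab ys orr →
      EvalR M (.call p x args cont) g0 g1 g2 lab ys (oq.append orr)

/-- Pointwise evaluation of the parameter-argument list of a state call. -/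
inductive EvalL (M : MFT) : List (RHS M.Q) → Forest → Forest → Forest →
    Option Label → List Forest → List Forest → Prop where
  | nil : ∀ g0 g1 g2 lab ys, EvalL M [] g0 g1 g2 lab ys []
  | cons : ∀ a as g0 g1 g2 lab ys v vs,
      EvalR M a g0 g1 g2 lab ys v → EvalL M as g0 g1 g2 lab ys vs →
      EvalL M (a :: as) g0 g1 g2 lab ys (v :: vs)
end

/-- The translation realized by `M`: `⟦M⟧(f) = ⟦q₀⟧(f)` (as a binary relation;
for terminating MFTs this relation is a total function). -/
def MFT.Sem (M : MFT) : Forest → Forest → Prop :=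
  fun f g => Eval M M.q0 f [] g

/-- `M` is terminating: every state on every input with every parameter
assignment produces exactly one output. -/
def MFT.Terminating (M : MFT) : Prop :=
  ∀ (q : M.Q) (f : Forest) (ys : List Forest), ∃! out, Eval M q f ys out

/-- Size of a transducer: `|sig|` plus the sum of the sizes of all left-hand
sides and right-hand sides of its rules. -/
def MFT.size (M : MFT) : ℕ :=
  M.sig.card +
    ∑ q : M.Q, ((M.prm q + 2) + (M.ruleEps q).size
      + ((M.prm q + 4) + (M.ruleDef q).size)
      + ∑ a ∈ M.sig, ((M.ruleSym q a).elim 0 fun r => (M.prm q + 4) + r.size))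

/-- A forest transducer (FT): an MFT all of whose states have rank 1
(no accumulating parameters). -/
def MFT.IsFT (M : MFT) : Prop := ∀ q : M.Q, M.prm q = 0

/-- A macro tree transducer (MTT): an MFT whose rule right-hand sides are trees
in which every `Σ∪{%t}`-labeled node is binary. -/
def MFT.IsMTT (M : MFT) : Prop :=
  (∀ q a r, M.ruleSym q a = some r → r.isTree) ∧
  (∀ q : M.Q, (M.ruleEps q).isTree ∧ (M.ruleDef q).isTree)

/-- A top-down tree transducer (TT): an FT that is an MTT. -/
def MFT.IsTT (M : MFT) : Prop := M.IsFT ∧ M.IsMTT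

/-- `M` contains no stay moves. -/
def MFT.NoStay (M : MFT) : Prop :=
  (∀ q a r, M.ruleSym q a = some r → r.noStay) ∧
  (∀ q : M.Q, (M.ruleEps q).noStay ∧ (M.ruleDef q).noStay)

/-- Composition of translations (apply `T1` first, then `T2`). -/
def TransComp (T1 T2 : Forest → Forest → Prop) : Forest → Forest → Prop :=
  fun f g => ∃ h, T1 f h ∧ T2 h g

/-! ## Classes of (binary) tree translations -/

/-- Under the first-child next-sibling representation used here, forests are
represented by their binary XML trees, so the encoding `fcns`
(`fcns(ε)=ε`, `fcns(σ(f₁)f₂)=σ(fcns f₁, fcns f₂)`) is realized by the identity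
on the representation. -/
def fcns : Forest → Forest
  | .eps => .eps
  | .node l c r => .node l (fcns c) (fcns r)

/-- The class of binary tree translations of all (terminating) MFTs. -/
def MFTclass : Set (Forest → Forest → Prop) :=
  {T | ∃ M : MFT, M.WF ∧ M.Terminating ∧ T = fun f g => M.Sem f g}

/-- The class of tree translations of all (terminating) MTTs. -/
def MTTclass : Set (Forest → Forest → Prop) :=
  {T | ∃ M : MFT, M.WF ∧ M.Terminating ∧ M.IsMTT ∧ T = fun f g => M.Sem f g}

/-- The class of binary tree translations of all (terminating) FTs. -/
def FTclass : Set (Forest → Forest → Prop) :=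
  {T | ∃ M : MFT, M.WF ∧ M.Terminating ∧ M.IsFT ∧ T = fun f g => M.Sem f g}

/-- The class of tree translations of all (terminating) TTs. -/
def TTclass : Set (Forest → Forest → Prop) :=
  {T | ∃ M : MFT, M.WF ∧ M.Terminating ∧ M.IsTT ∧ T = fun f g => M.Sem f g}

/-- The evaluation mapping `eval_Σ` with distinguished binary symbol `@` (here
`d`): it interprets `d`-labeled binary nodes as forest concatenation and acts
as the identity on all other labels. -/
def evalMap (d : Label) : Forest → Forest
  | .eps => .eps
  | .node l c r =>
      if l = d then (evalMap d c).append (evalMap d r)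
      else .node l (evalMap d c) (evalMap d r)

/-- The translation (graph) of the evaluation mapping `eval` with
distinguished symbol `d`. -/
def evalTrans (d : Label) : Forest → Forest → Prop := fun f g => g = evalMap d f

/-- The class `EVAL` of all evaluation mappings. -/
def EVALclass : Set (Forest → Forest → Prop) :=
  {T | ∃ d : Label, T = evalTrans d}

/-- Composition of classes of translations:
`F ∘ G = { f ∘ g : f ∈ F, g ∈ G }` (apply a member of `F` first). -/
def classComp (F G : Set (Forest → Forest → Prop)) : Set (Forest → Forest → Prop) :=
  {T | ∃ t1 ∈ F, ∃ t2 ∈ G, T = TransComp t1 t2}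

/-! ## Determinism of the semantics -/

theorem Eval.deterministic {M : MFT} {q f ys o o'} (h : Eval M q f ys o)
    (h' : Eval M q f ys o') : o = o' := by
  refine Eval.rec
    (motive_1 := fun q f ys o _ => ∀ o', Eval M q f ys o' → o = o')
    (motive_2 := fun rh g0 g1 g2 lab ys o _ => ∀ o', EvalR M rh g0 g1 g2 lab ys o' → o = o')
    (motive_3 := fun as g0 g1 g2 lab ys vs _ => ∀ vs', EvalL M as g0 g1 g2 lab ys vs' → vs = vs')
    ?_ ?_ ?_ ?_ ?_ ?_ ?_ ?_ ?_ ?_ h o' h'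
  · intro q ys out _ ih o' h'
    cases h' with
    | eps _ _ _ h' => exact ih _ h'
  · intro q l c r rh ys out hr _ ih o' h'
    cases h' with
    | sym _ _ _ _ rh' _ _ hr' h' =>
      obtain rfl : rh = rh' := Option.some.inj (hr.symm.trans hr')
      exact ih _ h'
    | dflt _ _ _ _ _ _ hr' h' => simp [hr] at hr'
  · intro q l c r ys out hr _ ih o' h'
    cases h' with
    | sym _ _ _ _ rh' _ _ hr' h' => simp [hr] at hr'
    | dflt _ _ _ _ _ _ hr' h' => exact ih _ h'
  · intro _ _ _ _ _ o' h'
    cases h'; rfl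
  · intro _ _ _ _ _ _ _ _ _ _ _ _ ih1 ih2 o' h'
    cases h' with
    | node _ _ _ _ _ _ _ _ _ _ h1 h2 => rw [ih1 _ h1, ih2 _ h2]
  · intro _ _ _ _ _ _ _ _ _ _ _ ih1 ih2 o' h'
    cases h' with
    | tnode _ _ _ _ _ _ _ _ _ h1 h2 => rw [ih1 _ h1, ih2 _ h2]
  · intro _ _ _ _ _ _ _ _ _ ih o' h'
    cases h' with
    | param _ _ _ _ _ _ _ _ h1 => rw [ih _ h1]
  · intro _ _ _ _ _ _ _ _ _ _ _ _ _ _ _ ih1 ih2 ih3 o' h'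
    cases h' with
    | call _ _ _ _ _ _ _ _ _ _ _ _ h1 h2 h3 =>
      obtain rfl := ih1 _ h1
      rw [ih2 _ h2, ih3 _ h3]
  · intro _ _ _ _ _ vs' h'
    cases h'; rfl
  · intro _ _ _ _ _ _ _ _ _ _ _ ih1 ih2 vs' h'
    cases h' with
    | cons _ _ _ _ _ _ _ _ _ h1 h2 => rw [ih1 _ h1, ih2 _ h2]

theorem MFT.terminating_of_exists {M : MFT} (h : ∀ q f ys, ∃ o, Eval M q f ys o) :
    M.Terminating := fun q f ys =>
  (h q f ys).imp fun _ ho => ⟨ho, fun _ ho' => ho'.deterministic ho⟩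

namespace Forest

theorem append_eps (f : Forest) : f.append .eps = f := by
  induction f with
  | eps => rfl
  | node l c r _ ih => simp [append, ih]

theorem append_assoc (f g h : Forest) : (f.append g).append h = f.append (g.append h) := by
  induction f with
  | eps => rfl
  | node l c r _ ih => simp [append, ih]

end Forest

/-! ## Forest transducers as macro tree transducers -/

namespace RHS

/-- The right-hand side `t` followed by `k`, with forest concatenation replaced by passing the
remaining output as a parameter of the preceding state call. -/
def toTree {Q : Type} : RHS Q → RHS (Option Q) → RHS (Option Q)
  | .eps, k => k
  | .node l c r, k => .node l (c.toTree .eps) (r.toTree k)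
  | .tnode c r, k => .tnode (c.toTree .eps) (r.toTree k)
  | .param _ r, k => r.toTree k
  | .call p x _ r, k => .call (some p) x [r.toTree k] .eps

theorem noT_toTree {Q : Type} : ∀ (t : RHS Q) (k : RHS (Option Q)), t.noT → k.noT →
    (t.toTree k).noT
  | .eps, k, _, hk => by simpa [toTree] using hk
  | .node l c r, k, ht, hk => by
    simp only [noT, toTree] at ht ⊢
    exact ⟨noT_toTree c _ ht.1 (by simp [noT]), noT_toTree r k ht.2 hk⟩
  | .tnode c r, k, ht, hk => by simp [noT] at ht
  | .param _ r, k, ht, hk => by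
    simp only [noT, toTree] at ht ⊢
    exact noT_toTree r k ht hk
  | .call p x _ r, k, ht, hk => by
    simp only [noT, noTL, toTree, and_true] at ht ⊢
    exact noT_toTree r k ht.2 hk

theorem varsOnly0_toTree {Q : Type} : ∀ (t : RHS Q) (k : RHS (Option Q)), t.varsOnly0 →
    k.varsOnly0 → (t.toTree k).varsOnly0
  | .eps, k, _, hk => by simpa [toTree] using hk
  | .node l c r, k, ht, hk => by
    simp only [varsOnly0, toTree] at ht ⊢
    exact ⟨varsOnly0_toTree c _ ht.1 (by simp [varsOnly0]), varsOnly0_toTree r k ht.2 hk⟩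
  | .tnode c r, k, ht, hk => by
    simp only [varsOnly0, toTree] at ht ⊢
    exact ⟨varsOnly0_toTree c _ ht.1 (by simp [varsOnly0]), varsOnly0_toTree r k ht.2 hk⟩
  | .param _ r, k, ht, hk => by
    simp only [varsOnly0, toTree] at ht ⊢
    exact varsOnly0_toTree r k ht hk
  | .call p x _ r, k, ht, hk => by
    simp only [varsOnly0, varsOnly0L, toTree, and_true] at ht ⊢
    exact ⟨ht.1, varsOnly0_toTree r k ht.2.2 hk⟩

theorem labelsIn_toTree {Q : Type} (S : Finset Label) : ∀ (t : RHS Q) (k : RHS (Option Q)),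
    t.labelsIn S → k.labelsIn S → (t.toTree k).labelsIn S
  | .eps, k, _, hk => by simpa [toTree] using hk
  | .node l c r, k, ht, hk => by
    simp only [labelsIn, toTree] at ht ⊢
    exact ⟨ht.1, labelsIn_toTree S c _ ht.2.1 (by simp [labelsIn]),
      labelsIn_toTree S r k ht.2.2 hk⟩
  | .tnode c r, k, ht, hk => by
    simp only [labelsIn, toTree] at ht ⊢
    exact ⟨labelsIn_toTree S c _ ht.1 (by simp [labelsIn]), labelsIn_toTree S r k ht.2 hk⟩
  | .param _ r, k, ht, hk => by
    simp only [labelsIn, toTree] at ht ⊢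
    exact labelsIn_toTree S r k ht hk
  | .call p x _ r, k, ht, hk => by
    simp only [labelsIn, labelsInL, toTree, and_true] at ht ⊢
    exact labelsIn_toTree S r k ht.2 hk

theorem arityOK_toTree {Q : Type} {prm : Option Q → ℕ} (hp : ∀ q, prm (some q) = 1) (m : ℕ) :
    ∀ (t : RHS Q) (k : RHS (Option Q)), k.arityOK prm m → (t.toTree k).arityOK prm m
  | .eps, k, hk => by simpa [toTree] using hk
  | .node l c r, k, hk => by
    simp only [arityOK, toTree]
    exact ⟨arityOK_toTree hp m c _ (by simp [arityOK]), arityOK_toTree hp m r k hk⟩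
  | .tnode c r, k, hk => by
    simp only [arityOK, toTree]
    exact ⟨arityOK_toTree hp m c _ (by simp [arityOK]), arityOK_toTree hp m r k hk⟩
  | .param _ r, k, hk => by
    simp only [toTree]
    exact arityOK_toTree hp m r k hk
  | .call p x _ r, k, hk => by
    simp only [arityOK, arityOKL, toTree, hp, and_true, List.length_singleton, true_and]
    exact arityOK_toTree hp m r k hk

theorem isTree_toTree {Q : Type} : ∀ (t : RHS Q) (k : RHS (Option Q)), k.isTree →
    (t.toTree k).isTree
  | .eps, k, hk => by simpa [toTree] using hk
  | .node l c r, k, hk => by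
    simp only [isTree, toTree]
    exact ⟨isTree_toTree c _ (by simp [isTree]), isTree_toTree r k hk⟩
  | .tnode c r, k, hk => by
    simp only [isTree, toTree]
    exact ⟨isTree_toTree c _ (by simp [isTree]), isTree_toTree r k hk⟩
  | .param _ r, k, hk => by
    simp only [toTree]
    exact isTree_toTree r k hk
  | .call p x _ r, k, hk => by
    simp only [isTree, isTreeL, toTree, and_true]
    exact isTree_toTree r k hk

end RHS

/-- The macro tree transducer simulating a forest transducer `M`: the state `some q` has one
parameter, which is appended to the output of `q`, and `none` is a fresh initial state. -/
def MFT.toMTT (M : MFT) : MFT where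
  Q := Option M.Q
  prm q := q.elim 0 fun _ => 1
  q0 := none
  sig := M.sig
  ruleSym q l := q.elim none fun q => (M.ruleSym q l).map (·.toTree (.param 0 .eps))
  ruleEps q := q.elim (.call (some M.q0) .x0 [.eps] .eps)
    fun q => (M.ruleEps q).toTree (.param 0 .eps)
  ruleDef q := q.elim (.call (some M.q0) .x0 [.eps] .eps)
    fun q => (M.ruleDef q).toTree (.param 0 .eps)

theorem MFT.WF.toMTT {M : MFT} (h : M.WF) : M.toMTT.WF := by
  obtain ⟨-, h2, h3, h4, h5⟩ := h
  have hp : ∀ q, M.toMTT.prm (some q) = 1 := fun _ => rfl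
  refine ⟨rfl, ?_, ?_, ?_, ?_⟩
  · rintro (_ | q) a ha
    · rfl
    · simp [MFT.toMTT, h2 q a ha]
  · rintro (_ | q) a r hr
    · simp [MFT.toMTT] at hr
    · obtain ⟨t, ht, rfl⟩ := Option.map_eq_some_iff.mp hr
      obtain ⟨h1, h2, -⟩ := h3 q a t ht
      exact ⟨RHS.noT_toTree _ _ h1 (by simp [RHS.noT]),
        RHS.labelsIn_toTree _ _ _ h2 (by simp [RHS.labelsIn]),
        RHS.arityOK_toTree hp _ _ _ (by simp [RHS.arityOK, hp])⟩
  · rintro (_ | q)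
    · simp [MFT.toMTT, RHS.noT, RHS.noTL, RHS.varsOnly0, RHS.varsOnly0L, RHS.labelsIn,
        RHS.labelsInL, RHS.arityOK, RHS.arityOKL]
    · obtain ⟨h1, h2, h3, -⟩ := h4 q
      exact ⟨RHS.noT_toTree _ _ h1 (by simp [RHS.noT]),
        RHS.varsOnly0_toTree _ _ h2 (by simp [RHS.varsOnly0]),
        RHS.labelsIn_toTree _ _ _ h3 (by simp [RHS.labelsIn]),
        RHS.arityOK_toTree hp _ _ _ (by simp [RHS.arityOK, hp])⟩
  · rintro (_ | q)
    · simp [MFT.toMTT, RHS.labelsIn, RHS.labelsInL, RHS.arityOK, RHS.arityOKL]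
    · exact ⟨RHS.labelsIn_toTree _ _ _ (h5 q).1 (by simp [RHS.labelsIn]),
        RHS.arityOK_toTree hp _ _ _ (by simp [RHS.arityOK, hp])⟩

theorem MFT.isMTT_toMTT (M : MFT) : M.toMTT.IsMTT := by
  refine ⟨?_, ?_⟩
  · rintro (_ | q) a r hr
    · simp [MFT.toMTT] at hr
    · obtain ⟨t, -, rfl⟩ := Option.map_eq_some_iff.mp hr
      exact RHS.isTree_toTree _ _ (by simp [RHS.isTree])
  · rintro (_ | q)
    · simp [MFT.toMTT, RHS.isTree, RHS.isTreeL]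
    · exact ⟨RHS.isTree_toTree _ _ (by simp [RHS.isTree]),
        RHS.isTree_toTree _ _ (by simp [RHS.isTree])⟩

theorem EvalR.param_zero (M : MFT) (g0 g1 g2 : Forest) (lab : Option Label) (ys : List Forest) :
    EvalR M (.param 0 .eps) g0 g1 g2 lab ys (ys.getD 0 .eps) := by
  simpa [Forest.append_eps] using EvalR.param (M := M) 0 .eps g0 g1 g2 lab ys .eps (.eps ..)

theorem MFT.IsFT.arityOK_zero {M : MFT} (hFT : M.IsFT) (hwf : M.WF) :
    (∀ q a r, M.ruleSym q a = some r → r.arityOK M.prm 0) ∧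
      (∀ q, (M.ruleEps q).arityOK M.prm 0) ∧ ∀ q, (M.ruleDef q).arityOK M.prm 0 := by
  obtain ⟨-, -, h3, h4, h5⟩ := hwf
  exact ⟨fun q a r hr => hFT q ▸ (h3 q a r hr).2.2, fun q => hFT q ▸ (h4 q).2.2.2,
    fun q => hFT q ▸ (h5 q).2⟩

theorem Eval.toMTT {M : MFT} (hFT : M.IsFT) (hwf : M.WF) {q f ys o} (h : Eval M q f ys o)
    (ys' : List Forest) : Eval M.toMTT (some q) f ys' (o.append (ys'.getD 0 .eps)) := by
  obtain ⟨hs, he, hd⟩ := hFT.arityOK_zero hwf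
  refine Eval.rec
    (motive_1 := fun q f ys o _ => ∀ ys' : List Forest,
      Eval M.toMTT (some q) f ys' (o.append (ys'.getD 0 .eps)))
    (motive_2 := fun rh g0 g1 g2 lab ys o _ => rh.arityOK M.prm 0 → ∀ (k : RHS (Option M.Q)) ys' ok,
      EvalR M.toMTT k g0 g1 g2 lab ys' ok →
      EvalR M.toMTT (rh.toTree k) g0 g1 g2 lab ys' (o.append ok))
    (motive_3 := fun as g0 g1 g2 lab ys vs _ => True)
    ?_ ?_ ?_ ?_ ?_ ?_ ?_ ?_ ?_ ?_ h ys'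
  · intro q ys out _ ih ys'
    exact .eps _ _ _ (ih (he q) _ _ _ (EvalR.param_zero ..))
  · intro q l c r rh ys out hr _ ih ys'
    exact .sym _ _ _ _ (rh.toTree (.param 0 .eps)) _ _ (by simp [MFT.toMTT, hr])
      (ih (hs _ _ _ hr) _ _ _ (EvalR.param_zero ..))
  · intro q l c r ys out hr _ ih ys'
    exact .dflt _ _ _ _ _ _ (by simp [MFT.toMTT, hr]) (ih (hd q) _ _ _ (EvalR.param_zero ..))
  · intro _ _ _ _ _ _ k ys' ok hk
    simpa [RHS.toTree, Forest.append] using hk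
  · intro l c r _ _ _ _ _ oc orr _ _ ih1 ih2 ha k ys' ok hk
    simp only [RHS.arityOK] at ha
    have := ih1 ha.1 .eps ys' .eps (.eps ..)
    rw [Forest.append_eps] at this
    simp only [RHS.toTree]
    exact .node _ _ _ _ _ _ _ _ _ _ this (ih2 ha.2 k ys' ok hk)
  · intro l c r _ _ _ _ oc orr _ _ ih1 ih2 ha k ys' ok hk
    simp only [RHS.arityOK] at ha
    have := ih1 ha.1 .eps ys' .eps (.eps ..)
    rw [Forest.append_eps] at this
    simp only [RHS.toTree]
    exact .tnode _ _ _ _ _ _ _ _ _ this (ih2 ha.2 k ys' ok hk)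
  · intro _ _ _ _ _ _ _ _ _ _ ha
    simp [RHS.arityOK] at ha
  · intro p x args cont g0 g1 g2 lab ys vs oq orr _ _ _ _ ih2 ih3 ha k ys' ok hk
    simp only [RHS.arityOK] at ha
    have h2 := ih2 [orr.append ok]
    rw [List.getD_cons_zero] at h2
    have := EvalR.call (M := M.toMTT) (some p) x [cont.toTree k] .eps g0 g1 g2 lab ys'
      [orr.append ok] _ .eps (.cons _ _ _ _ _ _ _ _ _ (ih3 ha.2.2 k ys' ok hk) (.nil ..)) h2 (.eps ..)
    rw [Forest.append_eps] at this
    simp only [RHS.toTree, Forest.append_assoc]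
    exact this
  · intros; trivial
  · intros; trivial

theorem Eval.toMTT_none {M : MFT} (hFT : M.IsFT) (hwf : M.WF) {f o} (h : Eval M M.q0 f [] o)
    (ys : List Forest) : Eval M.toMTT none f ys o := by
  have key : ∀ g1 g2 lab,
      EvalR M.toMTT (.call (some M.q0) .x0 [.eps] .eps) f g1 g2 lab ys o := by
    intro g1 g2 lab
    have h' := h.toMTT hFT hwf [.eps]
    rw [List.getD_cons_zero, Forest.append_eps] at h'
    have := EvalR.call (M := M.toMTT) (some M.q0) .x0 [.eps] .eps f g1 g2 lab ys [.eps] o .eps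
      (.cons _ _ _ _ _ _ _ _ _ (.eps ..) (.nil ..)) h' (.eps ..)
    rwa [Forest.append_eps] at this
  cases f with
  | eps => exact .eps _ _ _ (key ..)
  | node l c r => exact .dflt _ _ _ _ _ _ rfl (key ..)

theorem MFT.Terminating.toMTT {M : MFT} (hFT : M.IsFT) (hwf : M.WF) (hM : M.Terminating) :
    M.toMTT.Terminating := by
  refine MFT.terminating_of_exists ?_
  rintro (_ | q) f ys
  · obtain ⟨o, ho, -⟩ := hM M.q0 f []
    exact ⟨o, ho.toMTT_none hFT hwf ys⟩
  · obtain ⟨o, ho, -⟩ := hM q f []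
    exact ⟨_, ho.toMTT hFT hwf ys⟩

theorem FTclass_subset_MTTclass : FTclass ⊆ MTTclass := by
  rintro _ ⟨M, hwf, hM, hFT, rfl⟩
  refine ⟨M.toMTT, hwf.toMTT, hM.toMTT hFT hwf, M.isMTT_toMTT, ?_⟩
  funext f g
  refine propext ⟨fun h => h.toMTT_none hFT hwf [], fun h => ?_⟩
  obtain ⟨o, ho, -⟩ := hM M.q0 f []
  rwa [Eval.deterministic h (ho.toMTT_none hFT hwf [])]

/-! ## Growth of the output -/

/-- The largest value of `μ` on a list of forests. -/
def listMax (μ : Forest → ℕ) (ys : List Forest) : ℕ := (ys.map μ).foldr max 0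

theorem le_listMax_getD {μ : Forest → ℕ} (h0 : μ .eps = 0) (ys : List Forest) (j : ℕ) :
    μ (ys.getD j .eps) ≤ listMax μ ys := by
  induction ys generalizing j with
  | nil => simp [h0]
  | cons y ys ih =>
    cases j with
    | zero => simp [listMax]
    | succ j => exact (ih j).trans (by simp [listMax])

/-- On input `f`, every output of `M` exceeds the parameters by at most `m` with respect to `μ`. -/
def MFT.BoundedOn (M : MFT) (μ : Forest → ℕ) (f : Forest) (m : ℕ) : Prop :=
  ∀ q ys out, Eval M q f ys out → μ out ≤ m + listMax μ ys

theorem MFT.BoundedOn.mono {M : MFT} {μ f m n} (h : M.BoundedOn μ f m) (hmn : m ≤ n) :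
    M.BoundedOn μ f n := fun q ys out ho => (h q ys out ho).trans (by omega)

/-- The inputs `g0` and `g0'` select the same rules of `M`, and the outputs on the subtrees of
`g0'` are bounded by `m`. -/
def MFT.SameRules (M : MFT) (μ : Forest → ℕ) (g0 g1 g2 g0' g1' g2' : Forest) (m : ℕ) : Prop :=
  (g0 = .eps ∧ g1 = .eps ∧ g2 = .eps ∧ g0' = .eps ∧ g1' = .eps ∧ g2' = .eps) ∨
  ∃ l l', g0 = .node l g1 g2 ∧ g0' = .node l' g1' g2' ∧
    (∀ q, M.ruleSym q l = M.ruleSym q l') ∧ M.BoundedOn μ g1' m ∧ M.BoundedOn μ g2' m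

/-- Conditions under which the output growth `B` of `M` at a single input node with respect to
the measure `μ` can be controlled: `B K m` bounds the output in terms of a bound `m` for the
outputs on the subtrees and a constant `K`. -/
structure MFT.GrowthSetting (M : MFT) (μ : Forest → ℕ) (B : ℕ → ℕ → ℕ) : Prop where
  map_eps : μ .eps = 0
  map_node : ∀ l c r, μ (.node l c r) ≤ 1 + max (μ c) (μ r)
  mono : ∀ m, Monotone (B · m)
  le_zero : ∀ m, m ≤ B 0 m
  succ_le : ∀ K m, 1 + B K m ≤ B (K + 1) m
  tree_or_append : M.IsMTT ∨ ∀ f g : Forest, μ (f.append g) ≤ max (μ f) (μ g)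
  ft_or_add : M.IsFT ∨ ∀ K K' m, B K m + B K' m ≤ B (K + K' + 1) m

/-- A right-hand side whose calls have no arguments unless sums of bounds are bounds, and which
is a tree unless `μ` is compatible with concatenation. -/
def RHS.Controlled (μ : Forest → ℕ) (B : ℕ → ℕ → ℕ) {Q : Type} (rh : RHS Q) : Prop :=
  (rh.arityOK (fun _ => 0) 0 ∨ ∀ K K' m, B K m + B K' m ≤ B (K + K' + 1) m) ∧
  (rh.isTree ∨ ∀ f g : Forest, μ (f.append g) ≤ max (μ f) (μ g))

/-- The analogue of `RHS.Controlled` for argument lists. -/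
def RHS.ControlledL (μ : Forest → ℕ) (B : ℕ → ℕ → ℕ) {Q : Type} (as : List (RHS Q)) : Prop :=
  (RHS.arityOKL (fun _ => 0) 0 as ∨ ∀ K K' m, B K m + B K' m ≤ B (K + K' + 1) m) ∧
  (RHS.isTreeL as ∨ ∀ f g : Forest, μ (f.append g) ≤ max (μ f) (μ g))

namespace MFT.GrowthSetting

variable {M : MFT} {μ : Forest → ℕ} {B : ℕ → ℕ → ℕ}

theorem controlled (hG : M.GrowthSetting μ B) (hwf : M.WF) :
    (∀ q a r, M.ruleSym q a = some r → r.Controlled μ B) ∧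
      (∀ q, (M.ruleEps q).Controlled μ B) ∧ ∀ q, (M.ruleDef q).Controlled μ B := by
  have hA : ∀ rh : RHS M.Q, (∀ h : M.IsFT, rh.arityOK M.prm 0) →
      (M.IsMTT → rh.isTree) → rh.Controlled μ B := by
    intro rh h1 h2
    refine ⟨hG.ft_or_add.imp_left fun h => ?_, hG.tree_or_append.imp_left h2⟩
    have : M.prm = fun _ => 0 := funext h
    simpa [this] using h1 h
  exact ⟨fun q a r hr => hA _ (fun h => (h.arityOK_zero hwf).1 q a r hr) fun h => h.1 q a r hr,
    fun q => hA _ (fun h => (h.arityOK_zero hwf).2.1 q) fun h => (h.2 q).1,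
    fun q => hA _ (fun h => (h.arityOK_zero hwf).2.2 q) fun h => (h.2 q).2⟩

theorem exists_bound_of_eval (hG : M.GrowthSetting μ B) (hwf : M.WF) {q f ys o}
    (h : Eval M q f ys o) :
    ∃ K, ∀ g1 g2 f' g1' g2' m, M.SameRules μ f g1 g2 f' g1' g2' m → ∀ ys' o',
      Eval M q f' ys' o' → μ o' ≤ B K m + listMax μ ys' := by
  obtain ⟨hs, he, hd⟩ := hG.controlled hwf
  refine Eval.rec
    (motive_1 := fun q f ys o _ => ∃ K, ∀ g1 g2 f' g1' g2' m,
      M.SameRules μ f g1 g2 f' g1' g2' m → ∀ ys' o',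
        Eval M q f' ys' o' → μ o' ≤ B K m + listMax μ ys')
    (motive_2 := fun rh g0 g1 g2 lab ys o _ => rh.Controlled μ B → ∃ K, ∀ g0' g1' g2' m,
      M.SameRules μ g0 g1 g2 g0' g1' g2' m → ∀ lab' ys' o',
        EvalR M rh g0' g1' g2' lab' ys' o' → μ o' ≤ B K m + listMax μ ys')
    (motive_3 := fun as g0 g1 g2 lab ys vs _ => RHS.ControlledL μ B as → ∃ K, ∀ g0' g1' g2' m,
      M.SameRules μ g0 g1 g2 g0' g1' g2' m → ∀ lab' ys' vs',
        EvalL M as g0' g1' g2' lab' ys' vs' → listMax μ vs' ≤ B K m + listMax μ ys')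
    ?_ ?_ ?_ ?_ ?_ ?_ ?_ ?_ ?_ ?_ h
  · intro q ys out _ ih
    obtain ⟨K, hK⟩ := ih (he q)
    refine ⟨K, fun g1 g2 f' g1' g2' m hS ys' o' h' => ?_⟩
    obtain ⟨-, rfl, rfl, rfl, rfl, rfl⟩ | ⟨_, _, h0, -⟩ := hS
    · cases h' with
      | eps _ _ _ h' => exact hK _ _ _ m (.inl ⟨rfl, rfl, rfl, rfl, rfl, rfl⟩) _ _ _ h'
    · cases h0
  · intro q l c r rh ys out hr _ ih
    obtain ⟨K, hK⟩ := ih (hs _ _ _ hr)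
    refine ⟨K, fun g1 g2 f' g1' g2' m hS ys' o' h' => ?_⟩
    obtain ⟨h0, -⟩ | ⟨l, l', h0, rfl, hl, hb⟩ := hS
    · cases h0
    · cases h0
      cases h' with
      | sym _ _ _ _ rh' _ _ hr' h' =>
        obtain rfl : rh = rh' := Option.some.inj (hr.symm.trans ((hl q).trans hr'))
        exact hK _ _ _ m (.inr ⟨_, _, rfl, rfl, hl, hb⟩) _ _ _ h'
      | dflt _ _ _ _ _ _ hr' h' => simp [← hl, hr] at hr'
  · intro q l c r ys out hr _ ih
    obtain ⟨K, hK⟩ := ih (hd q)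
    refine ⟨K, fun g1 g2 f' g1' g2' m hS ys' o' h' => ?_⟩
    obtain ⟨h0, -⟩ | ⟨l, l', h0, rfl, hl, hb⟩ := hS
    · cases h0
    · cases h0
      cases h' with
      | sym _ _ _ _ rh' _ _ hr' h' => simp [← hl, hr] at hr'
      | dflt _ _ _ _ _ _ hr' h' => exact hK _ _ _ m (.inr ⟨_, _, rfl, rfl, hl, hb⟩) _ _ _ h'
  · intro _ _ _ _ _ _
    refine ⟨0, fun _ _ _ m _ lab' ys' o' h' => ?_⟩
    cases h'
    simp [hG.map_eps]
  · intro l c r _ _ _ _ _ _ _ _ _ ih1 ih2 hc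
    simp only [RHS.Controlled, RHS.arityOK, RHS.isTree] at hc
    obtain ⟨K1, h1⟩ := ih1 ⟨hc.1.imp_left And.left, hc.2.imp_left And.left⟩
    obtain ⟨K2, h2⟩ := ih2 ⟨hc.1.imp_left And.right, hc.2.imp_left And.right⟩
    refine ⟨max K1 K2 + 1, fun _ _ _ m hS lab' ys' o' h' => ?_⟩
    cases h' with
    | node _ _ _ _ _ _ _ _ oc orr e1 e2 =>
      have := h1 _ _ _ m hS _ _ _ e1
      have := h2 _ _ _ m hS _ _ _ e2
      have := hG.mono m (le_max_left K1 K2)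
      have := hG.mono m (le_max_right K1 K2)
      have := hG.succ_le (max K1 K2) m
      have := hG.map_node l oc orr
      simp only at *
      omega
  · intro l c r _ _ _ _ _ _ _ _ ih1 ih2 hc
    simp only [RHS.Controlled, RHS.arityOK, RHS.isTree] at hc
    obtain ⟨K1, h1⟩ := ih1 ⟨hc.1.imp_left And.left, hc.2.imp_left And.left⟩
    obtain ⟨K2, h2⟩ := ih2 ⟨hc.1.imp_left And.right, hc.2.imp_left And.right⟩
    refine ⟨max K1 K2 + 1, fun _ _ _ m hS lab' ys' o' h' => ?_⟩
    cases h' with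
    | tnode l' _ _ _ _ _ _ oc orr e1 e2 =>
      have := h1 _ _ _ m hS _ _ _ e1
      have := h2 _ _ _ m hS _ _ _ e2
      have := hG.mono m (le_max_left K1 K2)
      have := hG.mono m (le_max_right K1 K2)
      have := hG.succ_le (max K1 K2) m
      have := hG.map_node l' oc orr
      simp only at *
      omega
  · intro j r _ _ _ _ _ _ _ ih hc
    simp only [RHS.Controlled, RHS.arityOK, RHS.isTree, not_lt_zero, false_and, false_or] at hc
    obtain ⟨K, hK⟩ := ih ⟨.inr hc.1, hc.2.imp_left fun h => by simp [h, RHS.isTree]⟩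
    refine ⟨K, fun _ _ _ m hS lab' ys' o' h' => ?_⟩
    cases h' with
    | param _ _ _ _ _ _ _ orr e1 =>
      have h1 := le_listMax_getD hG.map_eps ys' j
      obtain rfl | hap := hc.2
      · cases e1
        rw [Forest.append_eps]
        omega
      · have := hK _ _ _ m hS _ _ _ e1
        have := hap (ys'.getD j .eps) orr
        omega
  · intro p x args cont g0 g1 g2 lab ys vs oq orr _ _ _ ih1 ih2 ih3 hc
    simp only [RHS.Controlled, RHS.arityOK, RHS.isTree] at hc
    obtain ⟨K1, h1⟩ := ih1 ⟨hc.1.imp_left fun h => h.2.1, hc.2.imp_left And.left⟩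
    obtain ⟨K2, h2⟩ := ih2
    obtain ⟨K3, h3⟩ := ih3 ⟨hc.1.imp_left fun h => h.2.2,
      hc.2.imp_left fun h => by simp [h.2, RHS.isTree]⟩
    refine ⟨max (K2 + K1 + 1) K3, fun g0' g1' g2' m hS lab' ys' o' h' => ?_⟩
    cases h' with
    | call _ _ _ _ _ _ _ _ _ vs' oq' orr' e1 e2 e3 =>
      have b1 := h1 _ _ _ m hS _ _ _ e1
      have b3 := h3 _ _ _ m hS _ _ _ e3
      have b2 : μ oq' ≤ B K2 m + listMax μ vs' := by
        have hsub : ∀ g, M.BoundedOn μ g m → Eval M p g vs' oq' →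
            μ oq' ≤ B K2 m + listMax μ vs' := fun g hg e => by
          have := hg _ _ _ e
          have := hG.le_zero m
          have := hG.mono m (Nat.zero_le K2)
          simp only at this
          omega
        obtain ⟨rfl, rfl, rfl, rfl, rfl, rfl⟩ | ⟨l, l', rfl, rfl, hl, hb1, hb2⟩ := hS
        · exact h2 .eps .eps _ .eps .eps m (.inl (by cases x <;> simp [XVar.sel])) _ _ e2
        · cases x with
          | x0 => exact h2 _ _ _ _ _ m (.inr ⟨l, l', rfl, rfl, hl, hb1, hb2⟩) _ _ e2
          | x1 => exact hsub _ hb1 e2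
          | x2 => exact hsub _ hb2 e2
      have m1 := hG.mono m (le_max_left (K2 + K1 + 1) K3)
      have m3 := hG.mono m (le_max_right (K2 + K1 + 1) K3)
      simp only at m1 m3
      have b2' : μ oq' ≤ B (K2 + K1 + 1) m + listMax μ ys' := by
        obtain ⟨hl, -⟩ | hadd := hc.1
        · obtain rfl := List.eq_nil_of_length_eq_zero hl
          cases e1
          have := hG.mono m (show K2 ≤ K2 + K1 + 1 by omega)
          simp only [listMax, List.map_nil, List.foldr_nil] at this b2 ⊢
          omega
        · have := hadd K2 K1 m
          omega
      obtain ⟨-, rfl⟩ | hap := hc.2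
      · cases e3
        rw [Forest.append_eps]
        omega
      · have := hap oq' orr'
        omega
  · intro _ _ _ _ _ _
    refine ⟨0, fun _ _ _ m _ lab' ys' vs' h' => ?_⟩
    cases h'
    simp [listMax]
  · intro a as _ _ _ _ _ _ _ _ _ ih1 ih2 hc
    simp only [RHS.ControlledL, RHS.arityOKL, RHS.isTreeL] at hc
    obtain ⟨K1, h1⟩ := ih1 ⟨hc.1.imp_left And.left, hc.2.imp_left And.left⟩
    obtain ⟨K2, h2⟩ := ih2 ⟨hc.1.imp_left And.right, hc.2.imp_left And.right⟩
    refine ⟨max K1 K2, fun _ _ _ m hS lab' ys' vs' h' => ?_⟩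
    cases h' with
    | cons _ _ _ _ _ _ _ v vs e1 e2 =>
      have b1 := h1 _ _ _ m hS _ _ _ e1
      have b2 := h2 _ _ _ m hS _ _ _ e2
      have := hG.mono m (le_max_left K1 K2)
      have := hG.mono m (le_max_right K1 K2)
      have hl : listMax μ (v :: vs) = max (μ v) (listMax μ vs) := rfl
      simp only at *
      omega

theorem exists_bound (hG : M.GrowthSetting μ B) (hwf : M.WF) (hM : M.Terminating) :
    ∃ K, M.BoundedOn μ .eps (B K 0) ∧ ∀ l c r m, M.BoundedOn μ c m → M.BoundedOn μ r m →
      M.BoundedOn μ (.node l c r) (B K m) := by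
  have hE : ∀ q, ∃ K, ∀ ys' o', Eval M q .eps ys' o' → μ o' ≤ B K 0 + listMax μ ys' := by
    intro q
    obtain ⟨o, ho, -⟩ := hM q .eps []
    obtain ⟨K, hK⟩ := hG.exists_bound_of_eval hwf ho
    exact ⟨K, hK .eps .eps .eps .eps .eps 0 (.inl ⟨rfl, rfl, rfl, rfl, rfl, rfl⟩)⟩
  have hN : ∀ q l, ∃ K, ∀ l', (∀ p, M.ruleSym p l = M.ruleSym p l') → ∀ c r m,
      M.BoundedOn μ c m → M.BoundedOn μ r m → ∀ ys' o', Eval M q (.node l' c r) ys' o' →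
        μ o' ≤ B K m + listMax μ ys' := by
    intro q l
    obtain ⟨o, ho, -⟩ := hM q (.node l .eps .eps) []
    obtain ⟨K, hK⟩ := hG.exists_bound_of_eval hwf ho
    exact ⟨K, fun l' hl c r m hc hr =>
      hK .eps .eps _ c r m (.inr ⟨l, l', rfl, rfl, hl, hc, hr⟩)⟩
  choose KE hKE using hE
  choose KN hKN using hN
  have hD : ∃ K, ∀ q, ∀ l', l' ∉ M.sig → ∀ c r m,
      M.BoundedOn μ c m → M.BoundedOn μ r m → ∀ ys' o', Eval M q (.node l' c r) ys' o' →
        μ o' ≤ B K m + listMax μ ys' := by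
    by_cases hl : ∃ l, l ∉ M.sig
    · obtain ⟨l, hl⟩ := hl
      refine ⟨∑ q, KN q l, fun q l' hl' c r m hc hr ys' o' ho => ?_⟩
      have h1 := hKN q l l' (fun p => by rw [hwf.2.1 p l hl, hwf.2.1 p l' hl']) c r m hc hr _ _ ho
      have h2 := hG.mono m (Finset.single_le_sum (f := fun q => KN q l)
        (fun _ _ => Nat.zero_le _) (Finset.mem_univ q))
      simp only at h2
      omega
    · exact ⟨0, fun q l' hl' => absurd ⟨l', hl'⟩ hl⟩
  obtain ⟨KD, hKD⟩ := hD
  refine ⟨(∑ q, KE q) + (∑ q, ∑ l ∈ M.sig, KN q l) + KD, fun q ys o ho => ?_,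
    fun l c r m hc hr q ys o ho => ?_⟩
  · have h1 := hKE q _ _ ho
    have h2 := Finset.single_le_sum (f := KE) (fun _ _ => Nat.zero_le _) (Finset.mem_univ q)
    have h3 := hG.mono 0 (show KE q ≤ (∑ q, KE q) + (∑ q, ∑ l ∈ M.sig, KN q l) + KD by omega)
    simp only at h3
    omega
  · by_cases hl : l ∈ M.sig
    · have h1 := hKN q l l (fun _ => rfl) c r m hc hr _ _ ho
      have h2 := Finset.single_le_sum (f := KN q) (fun _ _ => Nat.zero_le _) hl
      have h4 := Finset.single_le_sum (f := fun q => ∑ l ∈ M.sig, KN q l)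
        (fun _ _ => Nat.zero_le _) (Finset.mem_univ q)
      have h3 := hG.mono m
        (show KN q l ≤ (∑ q, KE q) + (∑ q, ∑ l ∈ M.sig, KN q l) + KD by
          omega)
      simp only at h3
      omega
    · have h1 := hKD q l hl c r m hc hr _ _ ho
      have h3 := hG.mono m (show KD ≤ (∑ q, KE q) + (∑ q, ∑ l ∈ M.sig, KN q l) + KD by omega)
      simp only at h3
      omega

end MFT.GrowthSetting

/-- The forest of `n` trees, each a single node labeled `l`. -/
def Forest.chain (l : Label) : ℕ → Forest
  | 0 => .eps
  | n + 1 => .node l .eps (chain l n)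

theorem MFT.exists_linear_bound {M : MFT} {μ : Forest → ℕ}
    (hG : M.GrowthSetting μ fun K m => m + K) (hwf : M.WF) (hM : M.Terminating) (l : Label) :
    ∃ K, ∀ n o, M.Sem (Forest.chain l n) o → μ o ≤ K * (n + 1) := by
  obtain ⟨K, h0, h1⟩ := hG.exists_bound hwf hM
  have key : ∀ n, M.BoundedOn μ (Forest.chain l n) (K * (n + 1)) := by
    intro n
    induction n with
    | zero => simpa [Forest.chain] using h0
    | succ n ih =>
      exact (h1 l _ _ _ (h0.mono (by nlinarith)) ih).mono (by nlinarith)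
  exact ⟨K, fun n o ho => by simpa [listMax] using key n _ _ _ ho⟩

theorem MFT.exists_exponential_bound {M : MFT} {μ : Forest → ℕ}
    (hG : M.GrowthSetting μ fun K m => (K + 1) * (m + 1)) (hwf : M.WF) (hM : M.Terminating)
    (l : Label) : ∃ K, ∀ n o, M.Sem (Forest.chain l n) o → μ o < K ^ (n + 1) := by
  obtain ⟨K, h0, h1⟩ := hG.exists_bound hwf hM
  have key : ∀ n, ∃ m, M.BoundedOn μ (Forest.chain l n) m ∧ K + 1 ≤ m ∧
      m < (K + 2) ^ (n + 1) := by
    intro n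
    induction n with
    | zero => exact ⟨K + 1, by simpa [Forest.chain] using h0, le_rfl, by simp⟩
    | succ n ih =>
      obtain ⟨m, hm, hK, hlt⟩ := ih
      refine ⟨(K + 1) * (m + 1), h1 l _ _ _ (h0.mono (by simpa using hK)) hm,
        by nlinarith, ?_⟩
      rw [pow_succ]
      nlinarith
  refine ⟨K + 2, fun n o ho => ?_⟩
  obtain ⟨m, hm, -, hlt⟩ := key n
  have : μ o ≤ m := by simpa [listMax] using hm _ _ _ ho
  omega

/-- The maximal nesting of labeled nodes in an unranked forest. -/
def Forest.depth : Forest → ℕ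
  | .eps => 0
  | .node _ c r => max (1 + c.depth) r.depth

theorem Forest.depth_append (f g : Forest) : (f.append g).depth = max f.depth g.depth := by
  induction f with
  | eps => simp [append, depth]
  | node l c r _ ih => simp [append, depth, ih, max_assoc]

theorem MFT.IsTT.growthSetting {M : MFT} (h : M.IsTT) :
    M.GrowthSetting Forest.height fun K m => m + K where
  map_eps := rfl
  map_node _ _ _ := le_rfl
  mono m _ _ hK := Nat.add_le_add_left hK m
  le_zero _ := le_rfl
  succ_le _ _ := by omega
  tree_or_append := .inl h.2
  ft_or_add := .inl h.1

theorem MFT.IsFT.growthSetting {M : MFT} (h : M.IsFT) :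
    M.GrowthSetting Forest.depth fun K m => m + K where
  map_eps := rfl
  map_node _ _ _ := by simp only [Forest.depth]; omega
  mono m _ _ hK := Nat.add_le_add_left hK m
  le_zero _ := le_rfl
  succ_le _ _ := by omega
  tree_or_append := .inr fun f g => (Forest.depth_append f g).le
  ft_or_add := .inl h

theorem MFT.IsMTT.growthSetting {M : MFT} (h : M.IsMTT) :
    M.GrowthSetting Forest.height fun K m => (K + 1) * (m + 1) where
  map_eps := rfl
  map_node _ _ _ := le_rfl
  mono m _ _ hK := Nat.mul_le_mul_right _ (Nat.add_le_add_right hK 1)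
  le_zero _ := by omega
  succ_le _ _ := by nlinarith
  tree_or_append := .inl h
  ft_or_add := .inr fun _ _ _ => by nlinarith

/-! ## Transducers separating the classes -/

/-- The label used by the separating transducers. -/
def sepLabel : Label := (.elem, ⟨[default], by simp⟩)

/-- The forest transducer with rules `q(ε) → a` and `q(%t(x₁)x₂) → q(x₂) q(x₂)`. -/
def widthFT : MFT where
  Q := Unit
  prm _ := 0
  q0 := ()
  sig := {sepLabel}
  ruleSym _ _ := none
  ruleEps _ := .node sepLabel .eps .eps
  ruleDef _ := .call () .x2 [] (.call () .x2 [] .eps)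

theorem widthFT_wf : widthFT.WF := by
  simp [MFT.WF, widthFT, RHS.noT, RHS.varsOnly0, RHS.labelsIn,
    RHS.labelsInL, RHS.arityOK, RHS.arityOKL]

/-- The output of `widthFT`. -/
def widthOut : Forest → Forest
  | .eps => .node sepLabel .eps .eps
  | .node _ _ r => (widthOut r).append (widthOut r)

theorem eval_widthFT (q : widthFT.Q) (f : Forest) (ys : List Forest) :
    Eval widthFT q f ys (widthOut f) := by
  induction f generalizing q ys with
  | eps => exact .eps _ _ _ (.node _ _ _ _ _ _ _ _ _ _ (.eps ..) (.eps ..))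
  | node l c r _ ih =>
    refine .dflt _ _ _ _ _ _ rfl ?_
    have h1 := EvalR.call (M := widthFT) () .x2 [] .eps (.node l c r) c r (some l) ys [] _ _
      (.nil ..) (ih _ _) (.eps ..)
    rw [Forest.append_eps] at h1
    exact .call _ _ _ _ _ _ _ _ _ _ _ _ (.nil ..) (ih _ _) h1

theorem Forest.chain_append (l : Label) (m n : ℕ) :
    (chain l m).append (chain l n) = chain l (m + n) := by
  induction m with
  | zero => simp [chain, append]
  | succ m ih => simp [chain, append, ih, Nat.add_right_comm]

theorem Forest.height_chain (l : Label) (n : ℕ) : (chain l n).height = n := by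
  induction n with
  | zero => rfl
  | succ n ih => simp [chain, height, ih, Nat.add_comm]

theorem widthOut_chain (l : Label) (n : ℕ) :
    widthOut (.chain l n) = .chain sepLabel (2 ^ n) := by
  induction n with
  | zero => rfl
  | succ n ih => simp [Forest.chain, widthOut, ih, Forest.chain_append, pow_succ, mul_two]

/-- The macro forest transducer with rules `q₀ → q(x₀, i)`, `q(ε, y) → e` and
`q(%t(x₁)x₂, y) → q(x₂, q(x₂, y))`, where the initial state is `false` and `q` is `true`. -/
def iterMFT (i e : RHS Bool) : MFT where
  Q := Bool
  prm q := if q then 1 else 0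
  q0 := false
  sig := {sepLabel}
  ruleSym _ _ := none
  ruleEps q := if q then e else .call true .x0 [i] .eps
  ruleDef q := if q then .call true .x2 [.call true .x2 [.param 0 .eps] .eps] .eps
    else .call true .x0 [i] .eps

/-- `F` applied `2 ^ n` times, where `n` is the number of trees of the given forest. -/
def iterOut (F : Forest → Forest) : Forest → Forest → Forest
  | .eps, y => F y
  | .node _ _ r, y => iterOut F r (iterOut F r y)

theorem iterOut_chain (F : Forest → Forest) (l : Label) (n : ℕ) (y : Forest) :
    iterOut F (.chain l n) y = F^[2 ^ n] y := by
  induction n generalizing y with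
  | zero => rfl
  | succ n ih => simp [Forest.chain, iterOut, ih, pow_succ, mul_two, Function.iterate_add_apply]

section iterMFT

variable {i e : RHS Bool} {F : Forest → Forest} {y : Forest}

theorem eval_iterMFT_true
    (he : ∀ ys, EvalR (iterMFT i e) e .eps .eps .eps none ys (F (ys.getD 0 .eps)))
    (f : Forest) (ys : List Forest) :
    Eval (iterMFT i e) true f ys (iterOut F f (ys.getD 0 .eps)) := by
  induction f generalizing ys with
  | eps => exact .eps _ _ _ (he ys)
  | node l c r _ ih =>
    refine .dflt _ _ _ _ _ _ rfl ?_
    have h1 := EvalR.call (M := iterMFT i e) true .x2 [.param 0 .eps] .eps (.node l c r) c r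
      (some l) ys [ys.getD 0 .eps] _ _
      (.cons _ _ _ _ _ _ _ _ _ (EvalR.param_zero ..) (.nil ..)) (ih _) (.eps ..)
    have h2 := EvalR.call (M := iterMFT i e) true .x2 _ .eps (.node l c r) c r
      (some l) ys _ _ _ (.cons _ _ _ _ _ _ _ _ _ h1 (.nil ..)) (ih _) (.eps ..)
    simp only [Forest.append_eps, List.getD_cons_zero] at h2
    exact h2

theorem eval_iterMFT_false
    (he : ∀ ys, EvalR (iterMFT i e) e .eps .eps .eps none ys (F (ys.getD 0 .eps)))
    (hi : ∀ g0 g1 g2 lab ys, EvalR (iterMFT i e) i g0 g1 g2 lab ys y)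
    (f : Forest) (ys : List Forest) :
    Eval (iterMFT i e) false f ys (iterOut F f y) := by
  have key : ∀ g1 g2 lab, EvalR (iterMFT i e) (.call true .x0 [i] .eps) f g1 g2 lab ys
      (iterOut F f y) := by
    intro g1 g2 lab
    have := EvalR.call (M := iterMFT i e) true .x0 [i] .eps f g1 g2 lab ys _ _ _
      (.cons _ _ _ _ _ _ _ _ _ (hi ..) (.nil ..)) (eval_iterMFT_true he f [y]) (.eps ..)
    simpa only [Forest.append_eps, List.getD_cons_zero] using this
  cases f with
  | eps => exact .eps _ _ _ (key ..)
  | node l c r => exact .dflt _ _ _ _ _ _ rfl (key ..)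

theorem terminating_iterMFT
    (he : ∀ ys, EvalR (iterMFT i e) e .eps .eps .eps none ys (F (ys.getD 0 .eps)))
    (hi : ∀ g0 g1 g2 lab ys, EvalR (iterMFT i e) i g0 g1 g2 lab ys y) :
    (iterMFT i e).Terminating := by
  refine MFT.terminating_of_exists ?_
  rintro (_ | _) f ys
  · exact ⟨_, eval_iterMFT_false he hi f ys⟩
  · exact ⟨_, eval_iterMFT_true he f ys⟩

end iterMFT

/-- The macro tree transducer producing exponentially nested output. -/
def nestMTT : MFT := iterMFT .eps (.node sepLabel (.param 0 .eps) .eps)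

/-- The macro forest transducer producing output of doubly exponential width. -/
def doubleMFT : MFT := iterMFT (.node sepLabel .eps .eps) (.param 0 (.param 0 .eps))

theorem nestMTT_wf : nestMTT.WF := by
  simp [MFT.WF, nestMTT, iterMFT, RHS.noT, RHS.noTL, RHS.varsOnly0, RHS.varsOnly0L, RHS.labelsIn,
    RHS.labelsInL, RHS.arityOK, RHS.arityOKL]

theorem doubleMFT_wf : doubleMFT.WF := by
  simp [MFT.WF, doubleMFT, iterMFT, RHS.noT, RHS.noTL, RHS.varsOnly0, RHS.varsOnly0L,
    RHS.labelsIn, RHS.labelsInL, RHS.arityOK, RHS.arityOKL]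

theorem nestMTT_isMTT : nestMTT.IsMTT := by
  simp [MFT.IsMTT, nestMTT, iterMFT, RHS.isTree, RHS.isTreeL]

theorem evalR_nestMTT_eps (ys : List Forest) :
    EvalR nestMTT (.node sepLabel (.param 0 .eps) .eps) .eps .eps .eps none ys
      (.node sepLabel (ys.getD 0 .eps) .eps) :=
  .node _ _ _ _ _ _ _ _ _ _ (EvalR.param_zero ..) (.eps ..)

theorem evalR_doubleMFT_eps (ys : List Forest) :
    EvalR doubleMFT (.param 0 (.param 0 .eps)) .eps .eps .eps none ys
      ((ys.getD 0 .eps).append (ys.getD 0 .eps)) :=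
  .param _ _ _ _ _ _ _ _ (EvalR.param_zero ..)

theorem sem_nestMTT (f : Forest) :
    nestMTT.Sem f (iterOut (fun y => .node sepLabel y .eps) f .eps) :=
  eval_iterMFT_false (F := fun y => .node sepLabel y .eps) evalR_nestMTT_eps
    (fun _ _ _ _ _ => .eps ..) f []

theorem sem_doubleMFT (f : Forest) :
    doubleMFT.Sem f (iterOut (fun y => y.append y) f (.chain sepLabel 1)) :=
  eval_iterMFT_false (F := fun y => y.append y) evalR_doubleMFT_eps
    (fun _ _ _ _ _ => .node _ _ _ _ _ _ _ _ _ _ (.eps ..) (.eps ..)) f []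

theorem nestMTT_terminating : nestMTT.Terminating :=
  terminating_iterMFT (F := fun y => .node sepLabel y .eps) evalR_nestMTT_eps
    (fun _ _ _ _ _ => .eps ..)

theorem doubleMFT_terminating : doubleMFT.Terminating :=
  terminating_iterMFT (F := fun y => y.append y) (y := .chain sepLabel 1) evalR_doubleMFT_eps
    (fun _ _ _ _ _ => .node _ _ _ _ _ _ _ _ _ _ (.eps ..) (.eps ..))

theorem depth_iterate_node (l : Label) (n : ℕ) :
    ((fun y => Forest.node l y .eps)^[n] .eps).depth = n := by
  induction n with
  | zero => rfl
  | succ n ih =>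
    rw [Function.iterate_succ_apply']
    simp [Forest.depth, ih, Nat.add_comm]

theorem iterate_append_chain (l : Label) (n : ℕ) :
    (fun y : Forest => y.append y)^[n] (.chain l 1) = .chain l (2 ^ n) := by
  induction n with
  | zero => rfl
  | succ n ih =>
    rw [Function.iterate_succ_apply', ih, Forest.chain_append, pow_succ, mul_two]

theorem exists_mul_lt_two_pow (K : ℕ) : ∃ n, K * (n + 1) < 2 ^ n := by
  suffices h : (K + 1) * (2 * K + 4 + 1) < 2 ^ (2 * K + 4) from ⟨2 * K + 4, by nlinarith⟩
  induction K with
  | zero => norm_num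
  | succ K ih =>
    have : 2 ^ (2 * (K + 1) + 4) = 4 * 2 ^ (2 * K + 4) := by ring
    rw [this]
    nlinarith

theorem exists_pow_le_two_pow_two_pow (K : ℕ) : ∃ n, K ^ (n + 1) ≤ 2 ^ 2 ^ n := by
  obtain ⟨n, hn⟩ := exists_mul_lt_two_pow K
  refine ⟨n, ?_⟩
  calc K ^ (n + 1) ≤ (2 ^ K) ^ (n + 1) := Nat.pow_le_pow_left Nat.lt_two_pow_self.le _
    _ = 2 ^ (K * (n + 1)) := (pow_mul ..).symm
    _ ≤ 2 ^ 2 ^ n := Nat.pow_le_pow_right two_pos hn.le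

theorem widthFT_notMem_TTclass : widthFT.Sem ∉ TTclass := by
  rintro ⟨M, hwf, hM, hTT, hE⟩
  obtain ⟨K, hK⟩ := M.exists_linear_bound hTT.growthSetting hwf hM sepLabel
  obtain ⟨n, hn⟩ := exists_mul_lt_two_pow K
  have h : M.Sem (.chain sepLabel n) (widthOut (.chain sepLabel n)) :=
    (congrFun₂ hE _ _).mp (eval_widthFT _ _ _)
  have := hK n _ h
  rw [widthOut_chain, Forest.height_chain] at this
  omega

theorem nestMTT_notMem_FTclass : nestMTT.Sem ∉ FTclass := by
  rintro ⟨M, hwf, hM, hFT, hE⟩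
  obtain ⟨K, hK⟩ := M.exists_linear_bound hFT.growthSetting hwf hM sepLabel
  obtain ⟨n, hn⟩ := exists_mul_lt_two_pow K
  have := hK n _ ((congrFun₂ hE _ _).mp (sem_nestMTT (.chain sepLabel n)))
  rw [iterOut_chain, depth_iterate_node] at this
  omega

theorem doubleMFT_notMem_MTTclass : doubleMFT.Sem ∉ MTTclass := by
  rintro ⟨M, hwf, hM, hMTT, hE⟩
  obtain ⟨K, hK⟩ := M.exists_exponential_bound hMTT.growthSetting hwf hM sepLabel
  obtain ⟨n, hn⟩ := exists_pow_le_two_pow_two_pow K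
  have := hK n _ ((congrFun₂ hE _ _).mp (sem_doubleMFT (.chain sepLabel n)))
  rw [iterOut_chain, iterate_append_chain, Forest.height_chain] at this
  omega

/-- The strict inclusions `TT ⊊ FT ⊊ MTT ⊊ MFT` hold between
the classes of binary tree translations: every top-down tree transducer
translation is a forest transducer translation, every forest transducer
translation is a macro tree transducer translation, every macro tree
transducer translation is a macro forest transducer translation, and each
inclusion is strict. -/
theorem tt_ssubset_ft_ssubset_mtt_ssubset_mft :
    TTclass ⊂ FTclass ∧ FTclass ⊂ MTTclass ∧ MTTclass ⊂ MFTclass := by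
  refine ⟨ssubset_of_subset_not_superset ?_ fun h => widthFT_notMem_TTclass (h ?_),
    ssubset_of_subset_not_superset FTclass_subset_MTTclass
      fun h => nestMTT_notMem_FTclass (h ?_),
    ssubset_of_subset_not_superset ?_ fun h => doubleMFT_notMem_MTTclass (h ?_)⟩
  · rintro _ ⟨M, hwf, hM, hTT, rfl⟩
    exact ⟨M, hwf, hM, hTT.1, rfl⟩
  · exact ⟨widthFT, widthFT_wf,
      MFT.terminating_of_exists fun q f ys => ⟨_, eval_widthFT q f ys⟩, fun _ => rfl, rfl⟩
  · exact ⟨nestMTT, nestMTT_wf, nestMTT_terminating, nestMTT_isMTT, rfl⟩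
  · rintro _ ⟨M, hwf, hM, -, rfl⟩
    exact ⟨M, hwf, hM, rfl⟩
  · exact ⟨doubleMFT, doubleMFT_wf, doubleMFT_terminating, rfl⟩
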